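/- Let δ ∈ (0, 1/2), N ≥ 0, and let q : (0,∞) → ℝ be a measurable function with |q(u)| ≤ N u^{−1/2−δ} for all u > 0. Then for every t > 0: ∫₀ᵗ ( (t−s)^{−1/2} − t^{−1/2} ) s^{−3/2} ( ∫_s^t |q(u)| du ) ds ≤ 2 π Ω₁(δ) N t^{−1/2−δ}. -/

import Mathlib

open MeasureTheory Real

noncomputable section

/-- `Ω₁(δ) = (1/((1-2δ)π)) ∫₀¹ (1+(1-r)^{1/2})⁻¹ (1-r)^{-1/2} (r^{-1/2} - r^{-δ}) dr`. -/
def Omega1 (δ : ℝ) : ℝ :=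
  (1 / ((1 - 2 * δ) * Real.pi)) *
    ∫ r in (0 : ℝ)..1,
      (1 + (1 - r) ^ ((1 : ℝ) / 2))⁻¹ * (1 - r) ^ (-(1 : ℝ) / 2) *
        (r ^ (-(1 : ℝ) / 2) - r ^ (-δ))

lemma aux_pt (δ t r : ℝ) (ht : 0 < t) (hr0 : 0 < r) (hr1 : r < 1) :
    ((t - t * r) ^ (-(1 : ℝ) / 2) - t ^ (-(1 : ℝ) / 2)) * (t * r) ^ (-(3 : ℝ) / 2) *
      (t ^ (1 / 2 - δ) - (t * r) ^ (1 / 2 - δ)) =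
    t ^ (-(3 : ℝ) / 2 - δ) * ((1 + (1 - r) ^ ((1 : ℝ) / 2))⁻¹ * (1 - r) ^ (-(1 : ℝ) / 2) *
        (r ^ (-(1 : ℝ) / 2) - r ^ (-δ))) := by
  have h1 : 0 < 1 - r := by linarith
  have e1 : t - t * r = t * (1 - r) := by ring
  rw [e1, mul_rpow ht.le h1.le, mul_rpow ht.le hr0.le, mul_rpow ht.le hr0.le]
  have e2 : t ^ (-(3 : ℝ) / 2 - δ) =
      t ^ (-(1 : ℝ) / 2) * t ^ (-(3 : ℝ) / 2) * t ^ (1 / 2 - δ) := by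
    rw [← rpow_add ht, ← rpow_add ht]; congr 1; ring
  have e3 : r ^ (-(1 : ℝ) / 2) = r * r ^ (-(3 : ℝ) / 2) := by
    conv_rhs => rw [← rpow_one_add' hr0.le (by norm_num)]
    congr 1; norm_num
  have e4 : r ^ (-δ) = r * r ^ (-(3 : ℝ) / 2) * r ^ (1 / 2 - δ) := by
    rw [← e3, ← rpow_add hr0]; congr 1; ring
  have e5 : (1 - r) ^ (-(1 : ℝ) / 2) = ((1 - r) ^ ((1 : ℝ) / 2))⁻¹ := by
    rw [← rpow_neg h1.le]; congr 1; ring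
  have e6 : (1 - r) ^ ((1 : ℝ) / 2) * (1 - r) ^ ((1 : ℝ) / 2) = 1 - r := by
    rw [← rpow_add h1]; norm_num
  have hx : 0 < (1 - r) ^ ((1 : ℝ) / 2) := rpow_pos_of_pos h1 _
  rw [e2, e3, e4, e5]
  set x := (1 - r) ^ ((1 : ℝ) / 2)
  have e7 : x⁻¹ - 1 = (1 + x)⁻¹ * x⁻¹ * r := by
    have : r = 1 - x * x := by linarith
    rw [this]; field_simp; ring
  linear_combination (t ^ (-(1 : ℝ) / 2) * t ^ (-(3 : ℝ) / 2) * t ^ (1 / 2 - δ) *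
    r ^ (-(3 : ℝ) / 2) * (1 - r ^ (1 / 2 - δ))) * e7

lemma aux_nonneg (δ r : ℝ) (hδ : δ < 1 / 2) (hr0 : 0 < r) (hr1 : r < 1) :
    0 ≤ (1 + (1 - r) ^ ((1 : ℝ) / 2))⁻¹ * (1 - r) ^ (-(1 : ℝ) / 2) *
        (r ^ (-(1 : ℝ) / 2) - r ^ (-δ)) := by
  have h1 : 0 < 1 - r := by linarith
  have := rpow_le_rpow_of_exponent_ge hr0 hr1.le (show -(1 : ℝ) / 2 ≤ -δ by linarith)
  have h2 : 0 ≤ r ^ (-(1 : ℝ) / 2) - r ^ (-δ) := by linarith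
  positivity

lemma aux_le (δ r : ℝ) (hr0 : 0 < r) (hr1 : r < 1) :
    (1 + (1 - r) ^ ((1 : ℝ) / 2))⁻¹ * (1 - r) ^ (-(1 : ℝ) / 2) *
        (r ^ (-(1 : ℝ) / 2) - r ^ (-δ)) ≤ r ^ (-(1 : ℝ) / 2) + (1 - r) ^ (-(1 : ℝ) / 2) := by
  have h1 : 0 < 1 - r := by linarith
  have e5 : (1 - r) ^ (-(1 : ℝ) / 2) = ((1 - r) ^ ((1 : ℝ) / 2))⁻¹ := by
    rw [← rpow_neg h1.le]; congr 1; ring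
  have e5' : r ^ (-(1 : ℝ) / 2) = (r ^ ((1 : ℝ) / 2))⁻¹ := by
    rw [← rpow_neg hr0.le]; congr 1; ring
  have e6 : (1 - r) ^ ((1 : ℝ) / 2) * (1 - r) ^ ((1 : ℝ) / 2) = 1 - r := by
    rw [← rpow_add h1]; norm_num
  have e6' : r ^ ((1 : ℝ) / 2) * r ^ ((1 : ℝ) / 2) = r := by
    rw [← rpow_add hr0]; norm_num
  have hx : 0 < (1 - r) ^ ((1 : ℝ) / 2) := rpow_pos_of_pos h1 _
  have hy : 0 < r ^ ((1 : ℝ) / 2) := rpow_pos_of_pos hr0 _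
  have hz : 0 < r ^ (-δ) := rpow_pos_of_pos hr0 _
  rw [e5, e5']
  set x := (1 - r) ^ ((1 : ℝ) / 2)
  set y := r ^ ((1 : ℝ) / 2)
  have hxy : 1 ≤ x + y := by nlinarith [mul_pos hx hy]
  calc (1 + x)⁻¹ * x⁻¹ * (y⁻¹ - r ^ (-δ)) ≤ (1 + x)⁻¹ * x⁻¹ * y⁻¹ := by
        apply mul_le_mul_of_nonneg_left (by linarith); positivity
    _ ≤ 1 * x⁻¹ * y⁻¹ := by
        gcongr
        exact inv_le_one_of_one_le₀ (by linarith)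
    _ ≤ (x + y) * x⁻¹ * y⁻¹ := by gcongr
    _ = y⁻¹ + x⁻¹ := by field_simp

lemma aux_int (δ : ℝ) (hδ : δ < 1 / 2) :
    IntervalIntegrable (fun r : ℝ => (1 + (1 - r) ^ ((1 : ℝ) / 2))⁻¹ * (1 - r) ^ (-(1 : ℝ) / 2) *
        (r ^ (-(1 : ℝ) / 2) - r ^ (-δ))) volume 0 1 := by
  have i1 : IntervalIntegrable (fun r : ℝ => r ^ (-(1 : ℝ) / 2)) volume 0 1 :=
    intervalIntegral.intervalIntegrable_rpow' (by norm_num)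
  have i2 : IntervalIntegrable (fun r : ℝ => (1 - r) ^ (-(1 : ℝ) / 2)) volume 0 1 := by
    have := (i1.comp_sub_left 1).symm
    simpa using this
  have i3 := i1.add i2
  rw [intervalIntegrable_iff_integrableOn_Ioo_of_le zero_le_one] at i3 ⊢
  refine Integrable.mono' i3 ?_ ?_
  · apply Measurable.aestronglyMeasurable
    fun_prop
  · filter_upwards [ae_restrict_mem measurableSet_Ioo] with r hr
    rw [Real.norm_of_nonneg (aux_nonneg δ r hδ hr.1 hr.2)]
    exact aux_le δ r hr.1 hr.2

lemma aux_inner (δ : ℝ) (hδ : δ < 1 / 2)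
    (N : ℝ) (q : ℝ → ℝ) (hq_meas : Measurable q)
    (hq : ∀ u : ℝ, 0 < u → |q u| ≤ N * u ^ (-(1 : ℝ) / 2 - δ)) (s t : ℝ) (hs : 0 < s)
    (hst : s ≤ t) :
    ∫ u in s..t, |q u| ≤ N * ((t ^ (1 / 2 - δ) - s ^ (1 / 2 - δ)) / (1 / 2 - δ)) := by
  have h0 : (0 : ℝ) ∉ Set.uIcc s t := by
    rw [Set.uIcc_of_le hst]; intro h; exact absurd h.1 (not_le.2 hs)
  have i1 : IntervalIntegrable (fun u : ℝ => N * u ^ (-(1 : ℝ) / 2 - δ)) volume s t :=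
    (intervalIntegral.intervalIntegrable_rpow (Or.inr h0)).const_mul N
  have i2 : IntervalIntegrable (fun u : ℝ => |q u|) volume s t := by
    rw [intervalIntegrable_iff_integrableOn_Ioc_of_le hst] at i1 ⊢
    refine Integrable.mono' i1 (by apply Measurable.aestronglyMeasurable; fun_prop) ?_
    filter_upwards [ae_restrict_mem measurableSet_Ioc] with r hr
    simpa using hq r (hs.trans hr.1)
  have := intervalIntegral.integral_mono_on hst i2 i1 (fun u hu => hq u (hs.trans_le hu.1))
  refine this.trans (le_of_eq ?_)
  rw [intervalIntegral.integral_const_mul, integral_rpow (Or.inr ⟨by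
    intro h; linarith, h0⟩)]
  have : -(1 : ℝ) / 2 - δ + 1 = 1 / 2 - δ := by ring
  rw [this]

/-- If `|q(u)| ≤ N u^{-1/2-δ}` for all `u > 0`, then for every `t > 0`,
`∫₀ᵗ ((t-s)^{-1/2} - t^{-1/2}) s^{-3/2} (∫_s^t |q(u)| du) ds ≤ 2 π Ω₁(δ) N t^{-1/2-δ}`. -/
theorem integral_bound_Omega1 (δ : ℝ) (hδ : δ ∈ Set.Ioo (0 : ℝ) (1 / 2))
    (N : ℝ) (hN : 0 ≤ N) (q : ℝ → ℝ) (hq_meas : Measurable q)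
    (hq : ∀ u : ℝ, 0 < u → |q u| ≤ N * u ^ (-(1 : ℝ) / 2 - δ)) (t : ℝ) (ht : 0 < t) :
    ∫ s in (0 : ℝ)..t,
        ((t - s) ^ (-(1 : ℝ) / 2) - t ^ (-(1 : ℝ) / 2)) * s ^ (-(3 : ℝ) / 2) *
          (∫ u in s..t, |q u|) ≤
      2 * Real.pi * Omega1 δ * N * t ^ (-(1 : ℝ) / 2 - δ) := by
  obtain ⟨hδ0, hδ1⟩ := hδ
  have hd : 0 < 1 / 2 - δ := by linarith
  set g : ℝ → ℝ := fun r => (1 + (1 - r) ^ ((1 : ℝ) / 2))⁻¹ * (1 - r) ^ (-(1 : ℝ) / 2) *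
        (r ^ (-(1 : ℝ) / 2) - r ^ (-δ)) with hg
  set C : ℝ := N / (1 / 2 - δ) * t ^ (-(3 : ℝ) / 2 - δ) with hC
  have hgi : IntervalIntegrable g volume 0 1 := aux_int δ hδ1
  have hgt : IntervalIntegrable (fun s => C * g (s / t)) volume 0 t := by
    have := (hgi.comp_mul_right (c := t⁻¹)).const_mul C
    simpa [div_eq_mul_inv] using this
  have hval : ∫ s in (0 : ℝ)..t, C * g (s / t) =
      2 * Real.pi * Omega1 δ * N * t ^ (-(1 : ℝ) / 2 - δ) := by
    rw [intervalIntegral.integral_const_mul, intervalIntegral.integral_comp_div g ht.ne',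
      zero_div, div_self ht.ne', Omega1, smul_eq_mul, hC]
    have e : t ^ (-(1 : ℝ) / 2 - δ) = t ^ (-(3 : ℝ) / 2 - δ) * t := by
      rw [← rpow_add_one ht.ne']; congr 1; ring
    change _ = 2 * Real.pi * ((1 / ((1 - 2 * δ) * Real.pi)) * ∫ r in (0 : ℝ)..1, g r) * N * _
    rw [e]
    generalize ∫ r in (0 : ℝ)..1, g r = J
    have h2 : 1 - 2 * δ ≠ 0 := by intro h; linarith
    have h3 : 1 / 2 - δ = (1 - 2 * δ) / 2 := by ring
    rw [h3]
    have := Real.pi_ne_zero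
    field_simp
  rw [← hval, intervalIntegral.integral_of_le ht.le, intervalIntegral.integral_of_le ht.le,
    integral_Ioc_eq_integral_Ioo, integral_Ioc_eq_integral_Ioo]
  have hk : ∀ s ∈ Set.Ioo 0 t,
      0 ≤ ((t - s) ^ (-(1 : ℝ) / 2) - t ^ (-(1 : ℝ) / 2)) * s ^ (-(3 : ℝ) / 2) := by
    intro s hs
    have h1 : 0 < t - s := by linarith [hs.2]
    have := rpow_le_rpow_of_nonpos h1 (show t - s ≤ t by linarith [hs.1])
      (show -(1 : ℝ) / 2 ≤ 0 by norm_num)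
    exact mul_nonneg (by linarith) (rpow_nonneg hs.1.le _)
  refine integral_mono_of_nonneg ?_ ?_ ?_
  · filter_upwards [ae_restrict_mem measurableSet_Ioo] with s hs
    exact mul_nonneg (hk s hs) (intervalIntegral.integral_nonneg hs.2.le fun u _ => abs_nonneg _)
  · exact (intervalIntegrable_iff_integrableOn_Ioo_of_le ht.le).1 hgt
  · filter_upwards [ae_restrict_mem measurableSet_Ioo] with s hs
    refine (mul_le_mul_of_nonneg_left
      (aux_inner δ hδ1 N q hq_meas hq s t hs.1 hs.2.le) (hk s hs)).trans (le_of_eq ?_)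
    have hp := aux_pt δ t (s / t) ht (div_pos hs.1 ht) ((div_lt_one ht).2 hs.2)
    rw [mul_div_cancel₀ s ht.ne'] at hp
    rw [hC, hg]
    linear_combination (N / (1 / 2 - δ)) * hp
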